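/- Let Ω = [0,L₁] × [0,L₂] be a periodic domain divided into N equal closed squares Q₁,…,Q_N, each of side length l (so L₁ and L₂ are integer multiples of l and N l² = L₁L₂), and let x^j ∈ Q_j be arbitrary for j = 1,…,N. Then for every smooth function u : ℝ² → ℝ that is L₁-periodic in x₁ and L₂-periodic in x₂, ‖u‖² ≤ 4 l² N η(u)² + 68 l⁴ ‖Δu‖², where η(u) = max_{j=1,…,N} |u(x^j)|. -/

import Mathlib

open MeasureTheory Real

/-- First partial derivative of a function on `ℝ²`. -/
noncomputable def pd1 (f : ℝ × ℝ → ℝ) (p : ℝ × ℝ) : ℝ :=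
  deriv (fun s => f (s, p.2)) p.1

/-- Second partial derivative of a function on `ℝ²`. -/
noncomputable def pd2 (f : ℝ × ℝ → ℝ) (p : ℝ × ℝ) : ℝ :=
  deriv (fun s => f (p.1, s)) p.2

/-- The Laplacian `Δf = ∂₁²f + ∂₂²f`. -/
noncomputable def lap (f : ℝ × ℝ → ℝ) (p : ℝ × ℝ) : ℝ :=
  pd1 (pd1 f) p + pd2 (pd2 f) p

section PartialDerivatives

variable {f g : ℝ × ℝ → ℝ}

lemma ContDiff.hasDerivAt_pd1 (hf : ContDiff ℝ (⊤ : ℕ∞) f) (s t : ℝ) :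
    HasDerivAt (fun s => f (s, t)) (pd1 f (s, t)) s := by
  have h : Differentiable ℝ (fun s => f (s, t)) :=
    (hf.differentiable (by simp)).comp (by fun_prop : Differentiable ℝ fun s : ℝ => (s, t))
  exact (h s).hasDerivAt

lemma ContDiff.hasDerivAt_pd2 (hf : ContDiff ℝ (⊤ : ℕ∞) f) (s t : ℝ) :
    HasDerivAt (fun t => f (s, t)) (pd2 f (s, t)) t := by
  have h : Differentiable ℝ (fun t => f (s, t)) :=
    (hf.differentiable (by simp)).comp (by fun_prop : Differentiable ℝ fun t : ℝ => (s, t))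
  exact (h t).hasDerivAt

lemma ContDiff.pd1_eq_fderiv (hf : ContDiff ℝ (⊤ : ℕ∞) f) :
    pd1 f = fun p => fderiv ℝ f p (1, 0) := by
  funext p
  exact ((hf.differentiable (by simp) p).hasFDerivAt.comp_hasDerivAt p.1
    ((hasDerivAt_id p.1).prodMk (hasDerivAt_const p.1 p.2))).deriv

lemma ContDiff.pd2_eq_fderiv (hf : ContDiff ℝ (⊤ : ℕ∞) f) :
    pd2 f = fun p => fderiv ℝ f p (0, 1) := by
  funext p
  exact ((hf.differentiable (by simp) p).hasFDerivAt.comp_hasDerivAt p.2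
    ((hasDerivAt_const p.2 p.1).prodMk (hasDerivAt_id p.2))).deriv

protected lemma ContDiff.pd1 (hf : ContDiff ℝ (⊤ : ℕ∞) f) : ContDiff ℝ (⊤ : ℕ∞) (pd1 f) := by
  rw [hf.pd1_eq_fderiv]
  exact (hf.fderiv_right (m := (⊤ : ℕ∞)) (by simp)).clm_apply contDiff_const

protected lemma ContDiff.pd2 (hf : ContDiff ℝ (⊤ : ℕ∞) f) : ContDiff ℝ (⊤ : ℕ∞) (pd2 f) := by
  rw [hf.pd2_eq_fderiv]
  exact (hf.fderiv_right (m := (⊤ : ℕ∞)) (by simp)).clm_apply contDiff_const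

lemma ContDiff.pd1_pd2_comm (hf : ContDiff ℝ (⊤ : ℕ∞) f) : pd1 (pd2 f) =
    pd2 (pd1 f) := by
  have hd : Differentiable ℝ (fderiv ℝ f) :=
    (hf.fderiv_right (m := (⊤ : ℕ∞)) (by simp)).differentiable (by simp)
  have happ (v : ℝ × ℝ) (p : ℝ × ℝ) :
      fderiv ℝ (fun q => fderiv ℝ f q v) p = (fderiv ℝ (fderiv ℝ f) p).flip v := by
    rw [fderiv_clm_apply (hd p) (by fun_prop)]
    simp
  rw [hf.pd2.pd1_eq_fderiv, hf.pd1.pd2_eq_fderiv, hf.pd1_eq_fderiv, hf.pd2_eq_fderiv]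
  funext p
  rw [happ, happ]
  exact hf.contDiffAt.isSymmSndFDerivAt
    (by simpa using WithTop.coe_le_coe.2 (le_top : (2 : ℕ∞) ≤ ⊤)) _ _

lemma ContDiff.pd1_mul (hf : ContDiff ℝ (⊤ : ℕ∞) f) (hg : ContDiff ℝ (⊤ : ℕ∞) g)
    (p : ℝ × ℝ) : pd1 (f * g) p = pd1 f p * g p + f p * pd1 g p :=
  ((hf.hasDerivAt_pd1 p.1 p.2).mul (hg.hasDerivAt_pd1 p.1 p.2)).deriv

lemma ContDiff.pd2_mul (hf : ContDiff ℝ (⊤ : ℕ∞) f) (hg : ContDiff ℝ (⊤ : ℕ∞) g)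
    (p : ℝ × ℝ) : pd2 (f * g) p = pd2 f p * g p + f p * pd2 g p :=
  ((hf.hasDerivAt_pd2 p.1 p.2).mul (hg.hasDerivAt_pd2 p.1 p.2)).deriv

/-- `f` is `L`-periodic in the first variable. -/
def PeriodicFst (L : ℝ) (f : ℝ × ℝ → ℝ) : Prop := ∀ s t, f (s + L, t) = f (s, t)

/-- `f` is `L`-periodic in the second variable. -/
def PeriodicSnd (L : ℝ) (f : ℝ × ℝ → ℝ) : Prop := ∀ s t, f (s, t + L) = f (s, t)

variable {L : ℝ}

protected lemma PeriodicFst.pd1 (h : PeriodicFst L f) : PeriodicFst L (pd1 f) := fun s t => by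
  have := deriv_comp_add_const (fun s => f (s, t)) L s
  simpa only [_root_.pd1, h _ t] using this.symm

protected lemma PeriodicFst.pd2 (h : PeriodicFst L f) : PeriodicFst L (pd2 f) := fun s t => by
  simp only [_root_.pd2, h s]

protected lemma PeriodicSnd.pd2 (h : PeriodicSnd L f) : PeriodicSnd L (pd2 f) := fun s t => by
  have := deriv_comp_add_const (fun t => f (s, t)) L t
  simpa only [_root_.pd2, h s] using this.symm

protected lemma PeriodicSnd.pd1 (h : PeriodicSnd L f) : PeriodicSnd L (pd1 f) := fun s t => by
  simp only [_root_.pd1, h _ t]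

lemma PeriodicFst.mul (hf : PeriodicFst L f) (hg : PeriodicFst L g) :
    PeriodicFst L (f * g) := fun s t => by simp [hf s t, hg s t]

lemma PeriodicSnd.mul (hf : PeriodicSnd L f) (hg : PeriodicSnd L g) :
    PeriodicSnd L (f * g) := fun s t => by simp [hf s t, hg s t]

end PartialDerivatives

section RectangleIntegrals

variable {f g : ℝ × ℝ → ℝ} {A B : ℝ}

lemma Continuous.integrableOn_rectangle (hf : Continuous f) (a b c d : ℝ) :
    IntegrableOn f (Set.Icc a b ×ˢ Set.Icc c d) :=
  hf.continuousOn.integrableOn_compact (isCompact_Icc.prod isCompact_Icc)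

lemma Continuous.integral_rectangle_eq (hf : Continuous f) (hA : 0 ≤ A) (hB : 0 ≤ B) :
    ∫ p in Set.Icc 0 A ×ˢ Set.Icc 0 B, f p = ∫ s in 0..A, ∫ t in 0..B, f (s, t) := by
  rw [Measure.volume_eq_prod, setIntegral_prod f (hf.integrableOn_rectangle 0 A 0 B)]
  simp_rw [intervalIntegral.integral_of_le hA, intervalIntegral.integral_of_le hB,
    integral_Icc_eq_integral_Ioc]

lemma Continuous.integral_rectangle_eq_swap (hf : Continuous f) (hA : 0 ≤ A) (hB : 0 ≤ B) :
    ∫ p in Set.Icc 0 A ×ˢ Set.Icc 0 B, f p = ∫ t in 0..B, ∫ s in 0..A, f (s, t) := by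
  rw [Measure.volume_eq_prod, ← setIntegral_prod_swap, ← Measure.volume_eq_prod]
  exact (hf.comp continuous_swap).integral_rectangle_eq hB hA

lemma PeriodicFst.integral_pd1_eq_zero (h : PeriodicFst A f) (hf : ContDiff ℝ (⊤ : ℕ∞) f)
    (hA : 0 ≤ A) (hB : 0 ≤ B) :
    ∫ p in Set.Icc 0 A ×ˢ Set.Icc 0 B, pd1 f p = 0 := by
  rw [hf.pd1.continuous.integral_rectangle_eq_swap hA hB]
  have (t : ℝ) : ∫ s in 0..A, pd1 f (s, t) = 0 := by
    have hc : Continuous fun s => pd1 f (s, t) := hf.pd1.continuous.comp (by fun_prop)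
    rw [intervalIntegral.integral_eq_sub_of_hasDerivAt (fun s _ => hf.hasDerivAt_pd1 s t)
      (hc.intervalIntegrable _ _)]
    simpa [sub_eq_zero] using h 0 t
  simp [this]

lemma PeriodicSnd.integral_pd2_eq_zero (h : PeriodicSnd B f) (hf : ContDiff ℝ (⊤ : ℕ∞) f)
    (hA : 0 ≤ A) (hB : 0 ≤ B) :
    ∫ p in Set.Icc 0 A ×ˢ Set.Icc 0 B, pd2 f p = 0 := by
  rw [hf.pd2.continuous.integral_rectangle_eq hA hB]
  have (s : ℝ) : ∫ t in 0..B, pd2 f (s, t) = 0 := by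
    have hc : Continuous fun t => pd2 f (s, t) := hf.pd2.continuous.comp (by fun_prop)
    rw [intervalIntegral.integral_eq_sub_of_hasDerivAt (fun t _ => hf.hasDerivAt_pd2 s t)
      (hc.intervalIntegrable _ _)]
    simpa [sub_eq_zero] using h s 0
  simp [this]

lemma PeriodicFst.integral_pd1_mul (hf : PeriodicFst A f) (hg : PeriodicFst A g)
    (hf' : ContDiff ℝ (⊤ : ℕ∞) f) (hg' : ContDiff ℝ (⊤ : ℕ∞) g) (hA : 0 ≤ A) (hB : 0 ≤ B) :
    ∫ p in Set.Icc 0 A ×ˢ Set.Icc 0 B, pd1 f p * g p =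
      -∫ p in Set.Icc 0 A ×ˢ Set.Icc 0 B, f p * pd1 g p := by
  have h := (hf.mul hg).integral_pd1_eq_zero (hf'.mul hg') hA hB
  simp_rw [hf'.pd1_mul hg'] at h
  rw [integral_add] at h
  · linarith
  · exact (hf'.pd1.continuous.mul hg'.continuous).integrableOn_rectangle ..
  · exact (hf'.continuous.mul hg'.pd1.continuous).integrableOn_rectangle ..

lemma PeriodicSnd.integral_pd2_mul (hf : PeriodicSnd B f) (hg : PeriodicSnd B g)
    (hf' : ContDiff ℝ (⊤ : ℕ∞) f) (hg' : ContDiff ℝ (⊤ : ℕ∞) g) (hA : 0 ≤ A) (hB : 0 ≤ B) :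
    ∫ p in Set.Icc 0 A ×ˢ Set.Icc 0 B, pd2 f p * g p =
      -∫ p in Set.Icc 0 A ×ˢ Set.Icc 0 B, f p * pd2 g p := by
  have h := (hf.mul hg).integral_pd2_eq_zero (hf'.mul hg') hA hB
  simp_rw [hf'.pd2_mul hg'] at h
  rw [integral_add] at h
  · linarith
  · exact (hf'.pd2.continuous.mul hg'.continuous).integrableOn_rectangle ..
  · exact (hf'.continuous.mul hg'.pd2.continuous).integrableOn_rectangle ..

/-- `‖∇u‖² = -⟨u, Δu⟩` for periodic `u`. -/
lemma integral_grad_sq_eq (h1 : PeriodicFst A f) (h2 : PeriodicSnd B f)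
    (hf : ContDiff ℝ (⊤ : ℕ∞) f) (hA : 0 ≤ A) (hB : 0 ≤ B) :
    (∫ p in Set.Icc 0 A ×ˢ Set.Icc 0 B, pd1 f p ^ 2) +
        ∫ p in Set.Icc 0 A ×ˢ Set.Icc 0 B, pd2 f p ^ 2 =
      -∫ p in Set.Icc 0 A ×ˢ Set.Icc 0 B, f p * lap f p := by
  have e1 := h1.integral_pd1_mul h1.pd1 hf hf.pd1 hA hB
  have e2 := h2.integral_pd2_mul h2.pd2 hf hf.pd2 hA hB
  simp_rw [lap, mul_add, sq]
  rw [integral_add, e1, e2]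
  · ring
  · exact (hf.continuous.mul hf.pd1.pd1.continuous).integrableOn_rectangle ..
  · exact (hf.continuous.mul hf.pd2.pd2.continuous).integrableOn_rectangle ..

lemma integral_pd1_pd2_sq_eq (h1 : PeriodicFst A f) (h2 : PeriodicSnd B f)
    (hf : ContDiff ℝ (⊤ : ℕ∞) f) (hA : 0 ≤ A) (hB : 0 ≤ B) :
    ∫ p in Set.Icc 0 A ×ˢ Set.Icc 0 B, pd1 (pd2 f) p ^ 2 =
      ∫ p in Set.Icc 0 A ×ˢ Set.Icc 0 B, pd1 (pd1 f) p * pd2 (pd2 f) p := by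
  have e1 := h1.pd2.integral_pd1_mul h1.pd2.pd1 hf.pd2 hf.pd2.pd1 hA hB
  have e2 := h2.pd2.integral_pd2_mul h2.pd1.pd1 hf.pd2 hf.pd1.pd1 hA hB
  have hc : pd1 (pd1 (pd2 f)) = pd2 (pd1 (pd1 f)) := by
    rw [hf.pd1_pd2_comm, hf.pd1.pd1_pd2_comm]
  rw [hc, ← e2] at e1
  simp_rw [sq, e1, mul_comm]

/-- `4 ‖∂₁∂₂u‖² ≤ ‖Δu‖²` for periodic `u`. -/
lemma integral_pd1_pd2_sq_le (h1 : PeriodicFst A f) (h2 : PeriodicSnd B f)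
    (hf : ContDiff ℝ (⊤ : ℕ∞) f) (hA : 0 ≤ A) (hB : 0 ≤ B) :
    4 * ∫ p in Set.Icc 0 A ×ˢ Set.Icc 0 B, pd1 (pd2 f) p ^ 2 ≤
      ∫ p in Set.Icc 0 A ×ˢ Set.Icc 0 B, lap f p ^ 2 := by
  rw [integral_pd1_pd2_sq_eq h1 h2 hf hA hB, ← integral_const_mul]
  have c1 := hf.pd1.pd1.continuous
  have c2 := hf.pd2.pd2.continuous
  refine integral_mono ((by fun_prop : Continuous _).integrableOn_rectangle ..)
    (((c1.add c2).pow 2).integrableOn_rectangle ..) fun p => ?_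
  simp only [lap]
  nlinarith [sq_nonneg (pd1 (pd1 f) p - pd2 (pd2 f) p)]

/-- Tiling a rectangle by congruent squares, for iterated integrals. -/
lemma Continuous.sum_integral_squares (hf : Continuous f) (l : ℝ) (m n : ℕ) :
    ∑ j : Fin m × Fin n, ∫ t in ((j.2 : ℕ) : ℝ) * l..(((j.2 : ℕ) : ℝ) + 1) * l,
      ∫ s in ((j.1 : ℕ) : ℝ) * l..(((j.1 : ℕ) : ℝ) + 1) * l, f (s, t) =
    ∫ t in 0..(n : ℝ) * l, ∫ s in 0..(m : ℝ) * l, f (s, t) := by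
  have key (k : ℕ) (h : ℝ → ℝ) (hh : Continuous h) :
      ∑ i : Fin k, ∫ r in ((i : ℕ) : ℝ) * l..(((i : ℕ) : ℝ) + 1) * l, h r =
        ∫ r in 0..(k : ℝ) * l, h r := by
    rw [Fin.sum_univ_eq_sum_range (fun i : ℕ => ∫ r in (i : ℝ) * l..((i : ℝ) + 1) * l, h r)]
    have := intervalIntegral.sum_integral_adjacent_intervals (f := h) (μ := volume)
      (a := fun i : ℕ => (i : ℝ) * l) (n := k) fun _ _ => hh.intervalIntegrable _ _
    simpa using this
  have hcont (a b : ℝ) : Continuous fun t => ∫ s in a..b, f (s, t) :=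
    intervalIntegral.continuous_parametric_intervalIntegral_of_continuous'
      (f := fun t s => f (s, t)) (hf.comp continuous_swap) a b
  rw [Fintype.sum_prod_type_right]
  simp_rw [← intervalIntegral.integral_finsetSum
    fun (i : Fin m) _ => (hcont _ _).intervalIntegrable _ _]
  rw [key n _ (continuous_finsetSum _ fun i _ => hcont _ _)]
  exact intervalIntegral.integral_congr fun t _ => key m (fun s => f (s, t)) (by fun_prop)

end RectangleIntegrals

section LocalEstimates

/-- Cauchy–Schwarz for the fundamental theorem of calculus. -/
lemma sq_sub_le_mul_integral_sq {g g' : ℝ → ℝ} {a b x y : ℝ} (hg : ∀ s, HasDerivAt g (g' s) s)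
    (hg' : Continuous g') (hx : x ∈ Set.Icc a b) (hy : y ∈ Set.Icc a b) :
    (g x - g y) ^ 2 ≤ (b - a) * ∫ s in a..b, g' s ^ 2 := by
  wlog hxy : y ≤ x generalizing x y
  · rw [← neg_sub, neg_sq]
    exact this hy hx (le_of_not_ge hxy)
  have hcs : (g x - g y) ^ 2 ≤ (x - y) * ∫ s in y..x, g' s ^ 2 := by
    rcases hxy.eq_or_lt with rfl | hlt
    · simp
    have hint : ∫ s in y..x, g' s = g x - g y :=
      intervalIntegral.integral_eq_sub_of_hasDerivAt (fun s _ => hg s)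
        (hg'.intervalIntegrable _ _)
    set d := g x - g y
    have h0 : 0 ≤ ∫ s in y..x, ((x - y) * g' s - d) ^ 2 :=
      intervalIntegral.integral_nonneg hxy fun _ _ => sq_nonneg _
    have hexp : ∫ s in y..x, ((x - y) * g' s - d) ^ 2 =
        (x - y) * ((x - y) * (∫ s in y..x, g' s ^ 2) - d ^ 2) := by
      have : ∀ s, ((x - y) * g' s - d) ^ 2 =
          (x - y) ^ 2 * g' s ^ 2 - 2 * (x - y) * d * g' s + d ^ 2 := fun s => by ring
      simp_rw [this]
      rw [intervalIntegral.integral_add, intervalIntegral.integral_sub,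
        intervalIntegral.integral_const_mul, intervalIntegral.integral_const_mul, hint,
        intervalIntegral.integral_const, smul_eq_mul]
      · ring
      all_goals exact Continuous.intervalIntegrable (by fun_prop) _ _
    rw [hexp] at h0
    linarith [nonneg_of_mul_nonneg_right h0 (sub_pos.2 hlt)]
  have hmono : ∫ s in y..x, g' s ^ 2 ≤ ∫ s in a..b, g' s ^ 2 :=
    intervalIntegral.integral_mono_interval hy.1 hxy hx.2
      (Filter.Eventually.of_forall fun _ => sq_nonneg _)
      ((hg'.pow 2).intervalIntegrable _ _)
  exact hcs.trans (mul_le_mul (by linarith [hx.2, hy.1]) hmono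
    (intervalIntegral.integral_nonneg hxy fun _ _ => sq_nonneg _) (by linarith [hx.2, hx.1]))

/-- One-dimensional trace inequality. -/
lemma mul_sq_le_integral_sq {g g' : ℝ → ℝ} {a b y : ℝ} (hg : ∀ s, HasDerivAt g (g' s) s)
    (hg' : Continuous g') (hy : y ∈ Set.Icc a b) :
    (b - a) * g y ^ 2 ≤
      2 * (∫ s in a..b, g s ^ 2) + 2 * (b - a) ^ 2 * ∫ s in a..b, g' s ^ 2 := by
  have hgc : Continuous g := continuous_iff_continuousAt.2 fun s => (hg s).continuousAt
  have h : ∫ _ in a..b, g y ^ 2 ≤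
      ∫ s in a..b, (2 * g s ^ 2 + 2 * ((b - a) * ∫ s in a..b, g' s ^ 2)) := by
    refine intervalIntegral.integral_mono_on (hy.1.trans hy.2)
      (Continuous.intervalIntegrable (by fun_prop) _ _)
      (Continuous.intervalIntegrable (by fun_prop) _ _) fun s hs => ?_
    nlinarith [sq_sub_le_mul_integral_sq hg hg' hs hy, sq_nonneg (g s - (g y - g s))]
  rw [intervalIntegral.integral_add (Continuous.intervalIntegrable (by fun_prop) _ _)
    (Continuous.intervalIntegrable (by fun_prop) _ _), intervalIntegral.integral_const_mul,
    intervalIntegral.integral_const, intervalIntegral.integral_const, smul_eq_mul,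
    smul_eq_mul] at h
  linarith

/-- Estimate on a single square in terms of the value at one node. -/
lemma integral_sq_le_of_node {u : ℝ × ℝ → ℝ} (hu : ContDiff ℝ (⊤ : ℕ∞) u) {a a' b b' l : ℝ}
    (hl : 0 ≤ l) (ha : a' - a = l) (hb : b' - b = l) {y : ℝ × ℝ}
    (hy : y ∈ Set.Icc a a' ×ˢ Set.Icc b b') :
    ∫ t in b..b', ∫ s in a..a', u (s, t) ^ 2 ≤
      2 * l ^ 2 * u y ^ 2 + 8 * l ^ 2 * (∫ t in b..b', ∫ s in a..a', pd1 u (s, t) ^ 2) +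
      8 * l ^ 2 * (∫ t in b..b', ∫ s in a..a', pd2 u (s, t) ^ 2) +
      8 * l ^ 4 * (∫ t in b..b', ∫ s in a..a', pd1 (pd2 u) (s, t) ^ 2) := by
  obtain ⟨y₁, y₂⟩ := y
  obtain ⟨hy₁, hy₂⟩ := hy
  simp only at hy₁ hy₂
  have haa : a ≤ a' := by linarith
  have hbb : b ≤ b' := by linarith
  have c0 := hu.continuous
  have c1 := hu.pd1.continuous
  have c2 := hu.pd2.continuous
  have c12 := hu.pd2.pd1.continuous
  have hcont {f : ℝ × ℝ → ℝ} (hf : Continuous f) :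
      Continuous fun t => ∫ s in a..a', f (s, t) ^ 2 :=
    intervalIntegral.continuous_parametric_intervalIntegral_of_continuous'
      (f := fun t s => f (s, t) ^ 2) (by fun_prop) a a'
  have C0 := hcont c0
  have C1 := hcont c1
  have C2 := hcont c2
  have C12 := hcont c12
  set T := ∫ t in b..b', pd2 u (y₁, t) ^ 2
  have hrow (t : ℝ) (ht : t ∈ Set.Icc b b') : ∫ s in a..a', u (s, t) ^ 2 ≤
      4 * l ^ 2 * (∫ s in a..a', pd1 u (s, t) ^ 2) +
        (2 * l * u (y₁, y₂) ^ 2 + 4 * l ^ 2 * T) := by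
    have h : ∫ s in a..a', u (s, t) ^ 2 ≤ ∫ _ in a..a', (2 * u (y₁, y₂) ^ 2 +
        4 * l * (∫ s in a..a', pd1 u (s, t) ^ 2) + 4 * l * T) := by
      refine intervalIntegral.integral_mono_on haa
        (Continuous.intervalIntegrable (by fun_prop) _ _)
        (Continuous.intervalIntegrable (by fun_prop) _ _) fun s hs => ?_
      have i1 := sq_sub_le_mul_integral_sq (fun s => hu.hasDerivAt_pd1 s t)
        (by fun_prop) hs hy₁
      have i2 := sq_sub_le_mul_integral_sq (fun t => hu.hasDerivAt_pd2 y₁ t)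
        (by fun_prop) ht hy₂
      rw [ha] at i1
      rw [hb] at i2
      nlinarith [sq_nonneg (u (s, t) - u (y₁, t) - (u (y₁, t) - u (y₁, y₂))),
        sq_nonneg (u (s, t) - 2 * u (y₁, y₂))]
    rw [intervalIntegral.integral_const, ha, smul_eq_mul] at h
    linarith
  have hsquare := intervalIntegral.integral_mono_on (μ := volume) hbb
    (Continuous.intervalIntegrable (by fun_prop) _ _)
    (Continuous.intervalIntegrable (by fun_prop) _ _) hrow
  rw [intervalIntegral.integral_add (Continuous.intervalIntegrable (by fun_prop) _ _)
    (Continuous.intervalIntegrable (by fun_prop) _ _), intervalIntegral.integral_const_mul,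
    intervalIntegral.integral_const, hb, smul_eq_mul] at hsquare
  have htrace : l * T ≤ 2 * (∫ t in b..b', ∫ s in a..a', pd2 u (s, t) ^ 2) +
      2 * l ^ 2 * ∫ t in b..b', ∫ s in a..a', pd1 (pd2 u) (s, t) ^ 2 := by
    rw [← intervalIntegral.integral_const_mul, ← intervalIntegral.integral_const_mul,
      ← intervalIntegral.integral_const_mul,
      ← intervalIntegral.integral_add (Continuous.intervalIntegrable (by fun_prop) _ _)
        (Continuous.intervalIntegrable (by fun_prop) _ _)]
    refine intervalIntegral.integral_mono_on hbb
      (Continuous.intervalIntegrable (by fun_prop) _ _)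
      (Continuous.intervalIntegrable (by fun_prop) _ _) fun t _ => ?_
    rw [← ha]
    exact mul_sq_le_integral_sq (fun s => hu.pd2.hasDerivAt_pd1 s t) (by fun_prop) hy₁
  have hpos : 0 ≤ ∫ t in b..b', ∫ s in a..a', pd1 u (s, t) ^ 2 :=
    intervalIntegral.integral_nonneg hbb fun _ _ =>
      intervalIntegral.integral_nonneg haa fun _ _ => sq_nonneg _
  have hpos' := mul_nonneg (sq_nonneg l) hpos
  have htrace' := mul_le_mul_of_nonneg_left htrace (sq_nonneg l)
  linarith

end LocalEstimates

/-- `L²` estimate via determining nodes: if the periodic domain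
`Ω = [0,L₁] × [0,L₂]`, with `L₁ = n₁ l`, `L₂ = n₂ l`, is tiled by `N = n₁ n₂`
equal squares of side `l` and a node `x j` is chosen in each square, then
`‖u‖² ≤ 4 l² N η(u)² + 68 l⁴ ‖Δu‖²`, where `η(u) = max_j |u(x j)|`. -/
theorem nodes_L2_estimate
    (l : ℝ) (hl : 0 < l)
    (n₁ n₂ : ℕ) (hn₁ : 0 < n₁) (hn₂ : 0 < n₂)
    (L₁ L₂ : ℝ) (hL₁ : L₁ = (n₁ : ℝ) * l) (hL₂ : L₂ = (n₂ : ℝ) * l)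
    (x : Fin n₁ × Fin n₂ → ℝ × ℝ)
    (hx : ∀ j : Fin n₁ × Fin n₂, x j ∈
      Set.Icc ((j.1 : ℝ) * l) (((j.1 : ℝ) + 1) * l) ×ˢ
      Set.Icc ((j.2 : ℝ) * l) (((j.2 : ℝ) + 1) * l))
    (u : ℝ × ℝ → ℝ)
    (hsmooth : ContDiff ℝ (⊤ : ℕ∞) u)
    (hper1 : ∀ p : ℝ × ℝ, u (p.1 + L₁, p.2) = u p)
    (hper2 : ∀ p : ℝ × ℝ, u (p.1, p.2 + L₂) = u p) :
    (∫ p in Set.Icc (0 : ℝ) L₁ ×ˢ Set.Icc (0 : ℝ) L₂, (u p) ^ 2) ≤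
      4 * l ^ 2 * ((n₁ * n₂ : ℕ) : ℝ) * (⨆ j : Fin n₁ × Fin n₂, |u (x j)|) ^ 2 +
      68 * l ^ 4 * ∫ p in Set.Icc (0 : ℝ) L₁ ×ˢ Set.Icc (0 : ℝ) L₂, (lap u p) ^ 2 := by
  have hL₁' : 0 ≤ L₁ := by rw [hL₁]; positivity
  have hL₂' : 0 ≤ L₂ := by rw [hL₂]; positivity
  have p1 : PeriodicFst L₁ u := fun s t => hper1 (s, t)
  have p2 : PeriodicSnd L₂ u := fun s t => hper2 (s, t)
  have c0 := hsmooth.continuous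
  have c1 := hsmooth.pd1.continuous
  have c2 := hsmooth.pd2.continuous
  have c12 := hsmooth.pd2.pd1.continuous
  have clap : Continuous (lap u) :=
    hsmooth.pd1.pd1.continuous.add hsmooth.pd2.pd2.continuous
  set η := ⨆ j : Fin n₁ × Fin n₂, |u (x j)|
  have hη (j : Fin n₁ × Fin n₂) : u (x j) ^ 2 ≤ η ^ 2 := by
    rw [← sq_abs]
    exact pow_le_pow_left₀ (abs_nonneg _) (le_ciSup (f := fun j => |u (x j)|)
      (Set.finite_range _).bddAbove j) 2
  have hsum := Finset.sum_le_sum fun (j : Fin n₁ × Fin n₂) (_ : j ∈ Finset.univ) =>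
    (integral_sq_le_of_node hsmooth hl.le (by ring) (by ring) (hx j)).trans
      (add_le_add_left (add_le_add_left (add_le_add_left
        (mul_le_mul_of_nonneg_left (hη j) (by positivity : 0 ≤ 2 * l ^ 2)) _) _) _)
  simp only [Finset.sum_add_distrib, ← Finset.mul_sum] at hsum
  have htile {f : ℝ × ℝ → ℝ} (hf : Continuous f) :
      ∑ j : Fin n₁ × Fin n₂, ∫ t in ((j.2 : ℕ) : ℝ) * l..(((j.2 : ℕ) : ℝ) + 1) * l,
        ∫ s in ((j.1 : ℕ) : ℝ) * l..(((j.1 : ℕ) : ℝ) + 1) * l, f (s, t) ^ 2 =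
      ∫ p in Set.Icc (0 : ℝ) L₁ ×ˢ Set.Icc (0 : ℝ) L₂, f p ^ 2 := by
    have h := (hf.pow 2).integral_rectangle_eq_swap hL₁' hL₂'
    rw [hL₁, hL₂] at h ⊢
    exact ((hf.pow 2).sum_integral_squares l n₁ n₂).trans h.symm
  rw [htile c0, htile c1, htile c2, htile c12, Finset.sum_const, Finset.card_univ,
    Fintype.card_prod, Fintype.card_fin, Fintype.card_fin, nsmul_eq_mul] at hsum
  have hgrad := integral_grad_sq_eq p1 p2 hsmooth hL₁' hL₂'
  have hmixed := mul_le_mul_of_nonneg_left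
    (integral_pd1_pd2_sq_le p1 p2 hsmooth hL₁' hL₂') (by positivity : 0 ≤ l ^ 4)
  have hyoung : 0 ≤ (∫ p in Set.Icc (0 : ℝ) L₁ ×ˢ Set.Icc (0 : ℝ) L₂, u p ^ 2) +
      16 * l ^ 2 * (∫ p in Set.Icc (0 : ℝ) L₁ ×ˢ Set.Icc (0 : ℝ) L₂, u p * lap u p) +
      64 * l ^ 4 * ∫ p in Set.Icc (0 : ℝ) L₁ ×ˢ Set.Icc (0 : ℝ) L₂, lap u p ^ 2 := by
    rw [← integral_const_mul, ← integral_const_mul,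
      ← integral_add ((by fun_prop : Continuous _).integrableOn_rectangle ..)
        ((by fun_prop : Continuous _).integrableOn_rectangle ..),
      ← integral_add ((by fun_prop : Continuous _).integrableOn_rectangle ..)
        ((by fun_prop : Continuous _).integrableOn_rectangle ..)]
    refine integral_nonneg fun p => ?_
    have := sq_nonneg (u p + 8 * l ^ 2 * lap u p)
    simp only [Pi.zero_apply]
    linarith
  have hgrad' := congrArg (fun r => l ^ 2 * r) hgrad
  linarith
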